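/- Let (A, L) be a random financial network and b > 0. Then the infimum defining the outer risk ρ^O_b(A, L) = inf{ c ≥ 0 : ρ^I_c(A, L) ≤ b } is attained, i.e. ρ^I_{c*}(A, L) ≤ b for c* = ρ^O_b(A, L). -/

import Mathlib

open MeasureTheory

/-- Total liability vector: `ℓ̄_i = ∑_j ℓ_{ij}`. -/
noncomputable def lbar {N : ℕ} (ℓ : Fin N → Fin N → ℝ) : Fin N → ℝ := fun i => ∑ j, ℓ i j

/-- Relative liability matrix: `π_{ij} = ℓ_{ij}/ℓ̄_i` if `ℓ̄_i > 0`, else `0`. -/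
noncomputable def relPi {N : ℕ} (ℓ : Fin N → Fin N → ℝ) : Fin N → Fin N → ℝ :=
  fun i j => if 0 < lbar ℓ i then ℓ i j / lbar ℓ i else 0

/-- The Eisenberg–Noe clearing map `Φ(p, a, π, ℓ̄) = (πᵀp + a) ∧ ℓ̄`. -/
noncomputable def Phi {N : ℕ} (π : Fin N → Fin N → ℝ) (a lb p : Fin N → ℝ) : Fin N → ℝ :=
  fun i => min ((∑ j, π j i * p j) + a i) (lb i)

/-- The clearing vector `CV(a, ℓ)`: the (for `a ∈ ℝ^N_{++}` unique) nonnegative fixed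
point of the clearing map associated with the liability matrix `ℓ`. -/
noncomputable def clearingVec {N : ℕ} (a : Fin N → ℝ) (ℓ : Fin N → Fin N → ℝ) : Fin N → ℝ :=
  Classical.epsilon fun p => (∀ i, 0 ≤ p i) ∧ Phi (relPi ℓ) a (lbar ℓ) p = p

/-- The Eisenberg–Noe aggregation function `Λ(a, ℓ) = ∑_i (ℓ̄_i − CV_i(a, ℓ))`. -/
noncomputable def aggLoss {N : ℕ} (a : Fin N → ℝ) (ℓ : Fin N → Fin N → ℝ) : ℝ :=
  ∑ i, (lbar ℓ i - clearingVec a ℓ i)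

/-- The feasible total bailout-capital levels: constants `c` such that some admissible
random allocation `Y ∈ 𝒞` with `∑ᵢ Yᵢ = c` a.s. makes the system acceptable. -/
noncomputable def feas {Ω : Type*} [MeasurableSpace Ω] (P : Measure Ω) {N : ℕ}
    (η : (Ω → ℝ) → ℝ) (A : Ω → Fin N → ℝ) (L : Ω → Fin N → Fin N → ℝ) (b : ℝ) : Set ℝ :=
  {c : ℝ | ∃ Y : Ω → Fin N → ℝ, Measurable Y ∧ (∀ ω i, 0 ≤ Y ω i) ∧
    (∀ᵐ ω ∂P, ∑ i, Y ω i = c) ∧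
    η (fun ω => aggLoss (fun i => A ω i + Y ω i) (L ω)) ≤ b}

/-- The systemic risk measure `ρ_b(A, L)`. -/
noncomputable def sysRisk {Ω : Type*} [MeasurableSpace Ω] (P : Measure Ω) {N : ℕ}
    (η : (Ω → ℝ) → ℝ) (A : Ω → Fin N → ℝ) (L : Ω → Fin N → Fin N → ℝ) (b : ℝ) : ℝ :=
  sInf (feas P η A L b)

/-- The inner risk `ρ^I_c(A, L) = inf_{Y ∈ 𝒞^c} η(Λ(A+Y, L))`. -/
noncomputable def innerRisk {Ω : Type*} [MeasurableSpace Ω] (P : Measure Ω) {N : ℕ}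
    (η : (Ω → ℝ) → ℝ) (A : Ω → Fin N → ℝ) (L : Ω → Fin N → Fin N → ℝ) (c : ℝ) : ℝ :=
  sInf {r : ℝ | ∃ Y : Ω → Fin N → ℝ, Measurable Y ∧ (∀ ω i, 0 ≤ Y ω i) ∧
    (∀ᵐ ω ∂P, ∑ i, Y ω i = c) ∧
    r = η (fun ω => aggLoss (fun i => A ω i + Y ω i) (L ω))}

/-- The outer risk `ρ^O_b(A, L) = inf{c ≥ 0 : ρ^I_c(A, L) ≤ b}`. -/
noncomputable def outerRisk {Ω : Type*} [MeasurableSpace Ω] (P : Measure Ω) {N : ℕ}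
    (η : (Ω → ℝ) → ℝ) (A : Ω → Fin N → ℝ) (L : Ω → Fin N → Fin N → ℝ) (b : ℝ) : ℝ :=
  sInf {c : ℝ | 0 ≤ c ∧ innerRisk P η A L c ≤ b}

section ClearingVector

variable {N : ℕ}

lemma Phi_mono {π : Fin N → Fin N → ℝ} (hπ : ∀ i j, 0 ≤ π i j) (a lb : Fin N → ℝ) :
    Monotone (Phi π a lb) := by
  intro p q hpq i
  have h : ∑ j, π j i * p j ≤ ∑ j, π j i * q j :=
    Finset.sum_le_sum fun j _ => mul_le_mul_of_nonneg_left (hpq j) (hπ j i)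
  exact min_le_min (by linarith) le_rfl

lemma continuous_Phi (π : Fin N → Fin N → ℝ) (a lb : Fin N → ℝ) : Continuous (Phi π a lb) := by
  unfold Phi
  fun_prop

/-- Comparison principle: a subsolution of the clearing equation lies below every nonnegative
fixed point of the clearing map. -/
lemma le_of_le_Phi_of_fixed {π : Fin N → Fin N → ℝ} (hπ : ∀ i j, 0 ≤ π i j)
    {a lb p q : Fin N → ℝ} (ha : ∀ i, 0 < a i) (hp : p ≤ Phi π a lb p)
    (hq0 : ∀ i, 0 ≤ q i) (hq : Phi π a lb q = q) : p ≤ q := by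
  have hsum : ∀ i, 0 ≤ ∑ j, π j i * q j := fun i =>
    Finset.sum_nonneg fun j _ => mul_nonneg (hπ j i) (hq0 j)
  have hfix : ∀ i, q i < p i → q i = ∑ j, π j i * q j + a i := by
    intro i hi
    have h1 : p i ≤ lb i := (hp i).trans (min_le_right _ _)
    have h2 : min (∑ j, π j i * q j + a i) (lb i) = q i := congrFun hq i
    rcases min_choice (∑ j, π j i * q j + a i) (lb i) with h | h <;> linarith
  have hzero : ∀ i, q i = 0 → p i ≤ 0 := by
    intro i hi
    by_contra! h
    have := hfix i (by linarith)
    linarith [hsum i, ha i]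
  by_contra hcon
  obtain ⟨k, hk⟩ : ∃ k, q k < p k := by
    simpa [Pi.le_def] using hcon
  obtain ⟨i, -, hi⟩ := Finset.exists_max_image Finset.univ (fun j => p j / q j)
    ⟨k, Finset.mem_univ k⟩
  have hqk : 0 < q k := by linarith [hfix k hk, hsum k, ha k]
  have hratio : 1 < p i / q i :=
    ((one_lt_div hqk).2 hk).trans_le (hi k (Finset.mem_univ k))
  have hqi : 0 < q i := by
    refine (hq0 i).lt_of_ne fun h => ?_
    rw [← h, div_zero] at hratio
    linarith
  have hle : ∀ j, p j ≤ p i / q i * q j := by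
    intro j
    rcases (hq0 j).eq_or_lt with h | h
    · rw [← h, mul_zero]
      exact hzero j h.symm
    · exact (div_le_iff₀ h).1 (hi j (Finset.mem_univ j))
  have hqpi := hfix i ((one_lt_div hqi).1 hratio)
  have h1 : p i ≤ ∑ j, π j i * p j + a i := (hp i).trans (min_le_left _ _)
  have h2 : ∑ j, π j i * p j ≤ p i / q i * ∑ j, π j i * q j := by
    rw [Finset.mul_sum]
    refine Finset.sum_le_sum fun j _ => ?_
    calc π j i * p j ≤ π j i * (p i / q i * q j) := mul_le_mul_of_nonneg_left (hle j) (hπ j i)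
      _ = p i / q i * (π j i * q j) := by ring
  have h3 : p i = p i / q i * (∑ j, π j i * q j + a i) := by
    rw [← hqpi, div_mul_cancel₀ _ hqi.ne']
  nlinarith [ha i]

lemma lbar_nonneg {ℓ : Fin N → Fin N → ℝ} (hℓ : ∀ i j, 0 ≤ ℓ i j) (i : Fin N) :
    0 ≤ lbar ℓ i :=
  Finset.sum_nonneg fun j _ => hℓ i j

lemma relPi_nonneg {ℓ : Fin N → Fin N → ℝ} (hℓ : ∀ i j, 0 ≤ ℓ i j) (i j : Fin N) :
    0 ≤ relPi ℓ i j := by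
  unfold relPi
  split_ifs with h
  · exact div_nonneg (hℓ i j) h.le
  · exact le_rfl

/-- Fictitious-default iteration: iterates of the clearing map started at full payment. -/
noncomputable def clearingIter (a : Fin N → ℝ) (ℓ : Fin N → Fin N → ℝ) (n : ℕ) : Fin N → ℝ :=
  (Phi (relPi ℓ) a (lbar ℓ))^[n] (lbar ℓ)

lemma clearingIter_succ (a : Fin N → ℝ) (ℓ : Fin N → Fin N → ℝ) (n : ℕ) :
    clearingIter a ℓ (n + 1) = Phi (relPi ℓ) a (lbar ℓ) (clearingIter a ℓ n) :=
  Function.iterate_succ_apply' _ _ _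

lemma clearingIter_nonneg {a : Fin N → ℝ} {ℓ : Fin N → Fin N → ℝ} (ha : ∀ i, 0 < a i)
    (hℓ : ∀ i j, 0 ≤ ℓ i j) (n : ℕ) (i : Fin N) : 0 ≤ clearingIter a ℓ n i := by
  induction n generalizing i with
  | zero => exact lbar_nonneg hℓ i
  | succ n ih =>
    rw [clearingIter_succ]
    exact le_min (add_nonneg (Finset.sum_nonneg fun j _ =>
      mul_nonneg (relPi_nonneg hℓ j i) (ih j)) (ha i).le) (lbar_nonneg hℓ i)

lemma clearingIter_antitone (a : Fin N → ℝ) {ℓ : Fin N → Fin N → ℝ}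
    (hℓ : ∀ i j, 0 ≤ ℓ i j) : Antitone (clearingIter a ℓ) :=
  (Phi_mono (relPi_nonneg hℓ) a (lbar ℓ)).antitone_iterate_of_map_le
    fun _ => min_le_right _ _

lemma exists_tendsto_clearingIter {a : Fin N → ℝ} {ℓ : Fin N → Fin N → ℝ} (ha : ∀ i, 0 < a i)
    (hℓ : ∀ i j, 0 ≤ ℓ i j) :
    ∃ p : Fin N → ℝ, Filter.Tendsto (clearingIter a ℓ) Filter.atTop (nhds p) ∧
      (∀ i, 0 ≤ p i) ∧ Phi (relPi ℓ) a (lbar ℓ) p = p := by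
  have hbdd : ∀ i, BddBelow (Set.range fun n => clearingIter a ℓ n i) := fun i =>
    ⟨0, by rintro _ ⟨n, rfl⟩; exact clearingIter_nonneg ha hℓ n i⟩
  have hlim : Filter.Tendsto (clearingIter a ℓ) Filter.atTop
      (nhds fun i => ⨅ n, clearingIter a ℓ n i) :=
    tendsto_pi_nhds.2 fun i => tendsto_atTop_ciInf
      (fun m n hmn => clearingIter_antitone a hℓ hmn i) (hbdd i)
  refine ⟨_, hlim, fun i => le_ciInf fun n => clearingIter_nonneg ha hℓ n i, ?_⟩
  refine tendsto_nhds_unique (((continuous_Phi _ _ _).tendsto _).comp hlim) ?_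
  refine ((Filter.tendsto_add_atTop_iff_nat 1).2 hlim).congr fun n => ?_
  exact clearingIter_succ a ℓ n

lemma clearingVec_spec {a : Fin N → ℝ} {ℓ : Fin N → Fin N → ℝ} (ha : ∀ i, 0 < a i)
    (hℓ : ∀ i j, 0 ≤ ℓ i j) :
    (∀ i, 0 ≤ clearingVec a ℓ i) ∧
      Phi (relPi ℓ) a (lbar ℓ) (clearingVec a ℓ) = clearingVec a ℓ := by
  obtain ⟨p, -, hp⟩ := exists_tendsto_clearingIter ha hℓ
  exact Classical.epsilon_spec (p := fun p : Fin N → ℝ =>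
    (∀ i, 0 ≤ p i) ∧ Phi (relPi ℓ) a (lbar ℓ) p = p) ⟨p, hp⟩

lemma le_clearingVec {a p : Fin N → ℝ} {ℓ : Fin N → Fin N → ℝ} (ha : ∀ i, 0 < a i)
    (hℓ : ∀ i j, 0 ≤ ℓ i j) (hp : p ≤ Phi (relPi ℓ) a (lbar ℓ) p) : p ≤ clearingVec a ℓ :=
  le_of_le_Phi_of_fixed (relPi_nonneg hℓ) ha hp (clearingVec_spec ha hℓ).1
    (clearingVec_spec ha hℓ).2

lemma clearingVec_le_lbar {a : Fin N → ℝ} {ℓ : Fin N → Fin N → ℝ} (ha : ∀ i, 0 < a i)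
    (hℓ : ∀ i j, 0 ≤ ℓ i j) (i : Fin N) : clearingVec a ℓ i ≤ lbar ℓ i :=
  (congrFun (clearingVec_spec ha hℓ).2 i).symm.le.trans (min_le_right _ _)

lemma tendsto_clearingIter {a : Fin N → ℝ} {ℓ : Fin N → Fin N → ℝ} (ha : ∀ i, 0 < a i)
    (hℓ : ∀ i j, 0 ≤ ℓ i j) :
    Filter.Tendsto (clearingIter a ℓ) Filter.atTop (nhds (clearingVec a ℓ)) := by
  obtain ⟨p, hlim, hp0, hp⟩ := exists_tendsto_clearingIter ha hℓ
  have hspec := clearingVec_spec ha hℓ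
  have hpq : p = clearingVec a ℓ := le_antisymm (le_clearingVec ha hℓ hp.ge)
    (le_of_le_Phi_of_fixed (relPi_nonneg hℓ) ha hspec.2.ge hp0 hp)
  exact hpq ▸ hlim

lemma mul_clearingVec_le {a a' : Fin N → ℝ} {ℓ : Fin N → Fin N → ℝ} (ha : ∀ i, 0 < a i)
    (ha' : ∀ i, 0 < a' i) (hℓ : ∀ i j, 0 ≤ ℓ i j) {s : ℝ} (hs0 : 0 ≤ s) (hs1 : s ≤ 1)
    (h : ∀ i, s * a i ≤ a' i) (i : Fin N) : s * clearingVec a ℓ i ≤ clearingVec a' ℓ i := by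
  refine le_clearingVec (p := fun i => s * clearingVec a ℓ i) ha' hℓ (fun i => ?_) i
  have hle : clearingVec a ℓ i ≤ ∑ j, relPi ℓ j i * clearingVec a ℓ j + a i :=
    (congrFun (clearingVec_spec ha hℓ).2 i).symm.le.trans (min_le_left _ _)
  refine le_min ?_ ?_
  · calc s * clearingVec a ℓ i ≤ s * (∑ j, relPi ℓ j i * clearingVec a ℓ j + a i) :=
          mul_le_mul_of_nonneg_left hle hs0
      _ = ∑ j, relPi ℓ j i * (s * clearingVec a ℓ j) + s * a i := by
          rw [mul_add, Finset.mul_sum]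
          congr 1
          exact Finset.sum_congr rfl fun j _ => by ring
      _ ≤ _ := by gcongr; exact h i
  · exact (mul_le_of_le_one_left ((clearingVec_spec ha hℓ).1 i) hs1).trans
      (clearingVec_le_lbar ha hℓ i)

lemma aggLoss_nonneg {a : Fin N → ℝ} {ℓ : Fin N → Fin N → ℝ} (ha : ∀ i, 0 < a i)
    (hℓ : ∀ i j, 0 ≤ ℓ i j) : 0 ≤ aggLoss a ℓ :=
  Finset.sum_nonneg fun i _ => sub_nonneg.2 (clearingVec_le_lbar ha hℓ i)

lemma aggLoss_le_sum_lbar {a : Fin N → ℝ} {ℓ : Fin N → Fin N → ℝ} (ha : ∀ i, 0 < a i)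
    (hℓ : ∀ i j, 0 ≤ ℓ i j) : aggLoss a ℓ ≤ ∑ i, lbar ℓ i :=
  Finset.sum_le_sum fun i _ => sub_le_self _ ((clearingVec_spec ha hℓ).1 i)

lemma aggLoss_le_of_mul_le {a a' : Fin N → ℝ} {ℓ : Fin N → Fin N → ℝ} (ha : ∀ i, 0 < a i)
    (ha' : ∀ i, 0 < a' i) (hℓ : ∀ i j, 0 ≤ ℓ i j) {s : ℝ} (hs0 : 0 ≤ s) (hs1 : s ≤ 1)
    (h : ∀ i, s * a i ≤ a' i) :
    aggLoss a' ℓ ≤ s * aggLoss a ℓ + (1 - s) * ∑ i, lbar ℓ i := by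
  unfold aggLoss
  rw [Finset.mul_sum, Finset.mul_sum, ← Finset.sum_add_distrib]
  refine Finset.sum_le_sum fun i _ => ?_
  linarith [mul_clearingVec_le ha ha' hℓ hs0 hs1 h i]

lemma aggLoss_anti {a a' : Fin N → ℝ} {ℓ : Fin N → Fin N → ℝ} (ha : ∀ i, 0 < a i)
    (hℓ : ∀ i j, 0 ≤ ℓ i j) (h : ∀ i, a i ≤ a' i) : aggLoss a' ℓ ≤ aggLoss a ℓ := by
  simpa using aggLoss_le_of_mul_le ha (fun i => (ha i).trans_le (h i)) hℓ zero_le_one le_rfl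
    (by simpa using h)

lemma aggLoss_eq_zero {a : Fin N → ℝ} {ℓ : Fin N → Fin N → ℝ} (ha : ∀ i, 0 < a i)
    (hℓ : ∀ i j, 0 ≤ ℓ i j) (h : ∀ i, lbar ℓ i ≤ a i) : aggLoss a ℓ = 0 := by
  refine Finset.sum_eq_zero fun i _ => sub_eq_zero.2 (le_antisymm ?_ (clearingVec_le_lbar ha hℓ i))
  refine le_clearingVec ha hℓ (fun i => le_min ?_ le_rfl) i
  have : 0 ≤ ∑ j, relPi ℓ j i * lbar ℓ j :=
    Finset.sum_nonneg fun j _ => mul_nonneg (relPi_nonneg hℓ j i) (lbar_nonneg hℓ j)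
  linarith [h i]

lemma tendsto_aggLoss_add_atTop {a : Fin N → ℝ} {ℓ : Fin N → Fin N → ℝ} (ha : ∀ i, 0 < a i)
    (hℓ : ∀ i j, 0 ≤ ℓ i j) :
    Filter.Tendsto (fun n : ℕ => aggLoss (fun i => a i + n) ℓ) Filter.atTop (nhds 0) := by
  refine tendsto_const_nhds.congr' ?_
  filter_upwards [Filter.eventually_ge_atTop ⌈∑ i, lbar ℓ i⌉₊] with n hn
  refine (aggLoss_eq_zero (fun i => add_pos_of_pos_of_nonneg (ha i) n.cast_nonneg) hℓ
    fun i => ?_).symm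
  have h1 : lbar ℓ i ≤ ∑ i, lbar ℓ i :=
    Finset.single_le_sum (fun i _ => lbar_nonneg hℓ i) (Finset.mem_univ i)
  linarith [ha i, Nat.ceil_le.1 hn]

lemma tendsto_aggLoss_add_zero {a : Fin N → ℝ} {ℓ : Fin N → Fin N → ℝ} (ha : ∀ i, 0 < a i)
    (hℓ : ∀ i j, 0 ≤ ℓ i j) {u : ℕ → ℝ} (hu : ∀ n, 0 ≤ u n)
    (hlim : Filter.Tendsto u Filter.atTop (nhds 0)) :
    Filter.Tendsto (fun n => aggLoss (fun i => a i + u n) ℓ) Filter.atTop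
      (nhds (aggLoss a ℓ)) := by
  obtain ⟨m, hm, hma⟩ : ∃ m : ℝ, 0 < m ∧ ∀ i, m ≤ a i := by
    rcases isEmpty_or_nonempty (Fin N) with _ | _
    · exact ⟨1, one_pos, fun i => isEmptyElim i⟩
    · obtain ⟨k, hk⟩ := Finite.exists_min a
      exact ⟨a k, ha k, hk⟩
  have hlow : ∀ n, aggLoss a ℓ - u n / m * ∑ i, lbar ℓ i ≤ aggLoss (fun i => a i + u n) ℓ := by
    intro n
    have hpos : ∀ i, 0 < a i + u n := fun i => add_pos_of_pos_of_nonneg (ha i) (hu n)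
    have hmu : 0 < m + u n := add_pos_of_pos_of_nonneg hm (hu n)
    have hs1 : m / (m + u n) ≤ 1 := (div_le_one hmu).2 (by linarith [hu n])
    have h := aggLoss_le_of_mul_le hpos ha hℓ (div_pos hm hmu).le hs1 fun i => by
      rw [div_mul_eq_mul_div, div_le_iff₀ hmu]
      nlinarith [hma i, hu n]
    have h1 : m / (m + u n) * aggLoss (fun i => a i + u n) ℓ ≤ aggLoss (fun i => a i + u n) ℓ :=
      mul_le_of_le_one_left (aggLoss_nonneg hpos hℓ) hs1
    have h2 : 1 - m / (m + u n) ≤ u n / m := by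
      rw [one_sub_div hmu.ne', add_sub_cancel_left]
      exact div_le_div_of_nonneg_left (hu n) hm (by linarith [hu n])
    have h3 := mul_le_mul_of_nonneg_right h2
      (Finset.sum_nonneg fun i (_ : i ∈ Finset.univ) => lbar_nonneg hℓ i)
    linarith
  refine tendsto_of_tendsto_of_tendsto_of_le_of_le ?_ tendsto_const_nhds hlow fun n =>
    aggLoss_anti ha hℓ fun i => le_add_of_nonneg_right (hu n)
  simpa using tendsto_const_nhds.sub ((hlim.div_const m).mul_const (∑ i, lbar ℓ i))

end ClearingVector

section Measurability

variable {Ω : Type*} [MeasurableSpace Ω] {N : ℕ}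

lemma measurable_lbar {L : Ω → Fin N → Fin N → ℝ} (hL : Measurable L) (i : Fin N) :
    Measurable fun ω => lbar (L ω) i := by
  unfold lbar
  fun_prop

lemma measurable_relPi {L : Ω → Fin N → Fin N → ℝ} (hL : Measurable L) (i j : Fin N) :
    Measurable fun ω => relPi (L ω) i j := by
  have hLij : Measurable fun ω => L ω i j := by fun_prop
  exact Measurable.ite (measurableSet_lt measurable_const (measurable_lbar hL i))
    (hLij.div (measurable_lbar hL i)) measurable_const

lemma measurable_clearingIter {A : Ω → Fin N → ℝ} (hA : Measurable A)
    {L : Ω → Fin N → Fin N → ℝ} (hL : Measurable L) (n : ℕ) (i : Fin N) :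
    Measurable fun ω => clearingIter (A ω) (L ω) n i := by
  induction n generalizing i with
  | zero => exact measurable_lbar hL i
  | succ n ih =>
    simp_rw [clearingIter_succ]
    exact ((Finset.measurable_sum _ fun j _ => (measurable_relPi hL j i).mul (ih j)).add
      (measurable_pi_apply i |>.comp hA)).min (measurable_lbar hL i)

lemma measurable_aggLoss {A : Ω → Fin N → ℝ} (hA : Measurable A) (hApos : ∀ ω i, 0 < A ω i)
    {L : Ω → Fin N → Fin N → ℝ} (hL : Measurable L) (hLnn : ∀ ω i j, 0 ≤ L ω i j) :
    Measurable fun ω => aggLoss (A ω) (L ω) := by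
  refine Finset.measurable_sum _ fun i _ => (measurable_lbar hL i).sub ?_
  refine measurable_of_tendsto_metrizable (fun n => measurable_clearingIter hA hL n i) ?_
  exact tendsto_pi_nhds.2 fun ω =>
    tendsto_pi_nhds.1 (tendsto_clearingIter (hApos ω) (hLnn ω)) i

lemma integrable_aggLoss {P : Measure Ω} {A : Ω → Fin N → ℝ} (hA : Measurable A)
    (hApos : ∀ ω i, 0 < A ω i) {L : Ω → Fin N → Fin N → ℝ} (hL : Measurable L)
    (hLnn : ∀ ω i j, 0 ≤ L ω i j) (hLint : Integrable (fun ω => ∑ i, lbar (L ω) i) P) :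
    Integrable (fun ω => aggLoss (A ω) (L ω)) P := by
  refine hLint.mono' (measurable_aggLoss hA hApos hL hLnn).aestronglyMeasurable
    (Filter.Eventually.of_forall fun ω => ?_)
  rw [Real.norm_of_nonneg (aggLoss_nonneg (hApos ω) (hLnn ω))]
  exact aggLoss_le_sum_lbar (hApos ω) (hLnn ω)

/-- An `L¹`-continuous functional is continuous along dominated pointwise convergence. -/
lemma tendsto_of_dominated {P : Measure Ω} {η : (Ω → ℝ) → ℝ} {Z : Ω → ℝ}
    (hη : ∀ ε : ℝ, 0 < ε → ∃ δ : ℝ, 0 < δ ∧ ∀ X : Ω → ℝ,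
      Integrable X P → (∫ ω, |X ω - Z ω| ∂P) < δ → |η X - η Z| < ε)
    {X : ℕ → Ω → ℝ} {B : Ω → ℝ} (hB : Integrable B P) (hX : ∀ n, Integrable (X n) P)
    (hZ : Integrable Z P) (hXB : ∀ n ω, |X n ω| ≤ B ω)
    (hlim : ∀ ω, Filter.Tendsto (fun n => X n ω) Filter.atTop (nhds (Z ω))) :
    Filter.Tendsto (fun n => η (X n)) Filter.atTop (nhds (η Z)) := by
  have hint : Filter.Tendsto (fun n => ∫ ω, |X n ω - Z ω| ∂P) Filter.atTop (nhds 0) := by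
    have h := tendsto_integral_of_dominated_convergence (μ := P)
      (F := fun n ω => |X n ω - Z ω|) (f := fun _ => 0) (fun ω => B ω + |Z ω|)
      (fun n => ((hX n).sub hZ).abs.aestronglyMeasurable) (hB.add hZ.abs)
      (fun n => Filter.Eventually.of_forall fun ω => by
        rw [Real.norm_eq_abs, abs_abs]
        exact (abs_sub _ _).trans (by linarith [hXB n ω]))
      (Filter.Eventually.of_forall fun ω => by
        simpa using ((hlim ω).sub_const (Z ω)).abs)
    simpa using h
  rw [Metric.tendsto_atTop]
  intro ε hε
  obtain ⟨δ, hδ, hclose⟩ := hη ε hε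
  obtain ⟨n₀, hn₀⟩ := Filter.eventually_atTop.1 (hint.eventually_lt_const hδ)
  exact ⟨n₀, fun n hn => hclose _ (hX n) (hn₀ n hn)⟩

end Measurability

/-- The infimum defining the outer risk is attained:
`ρ^I_{c*}(A, L) ≤ b` for `c* = ρ^O_b(A, L)`. -/
theorem outerRisk_attained
    {Ω : Type*} [MeasurableSpace Ω] (P : Measure Ω) [IsProbabilityMeasure P]
    (N : ℕ) (hN : 1 ≤ N)
    (η : (Ω → ℝ) → ℝ)
    (hη_mono : ∀ X Y : Ω → ℝ, Integrable X P → Integrable Y P →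
      (∀ᵐ ω ∂P, X ω ≤ Y ω) → η X ≤ η Y)
    (hη_conv : ∀ X Y : Ω → ℝ, Integrable X P → Integrable Y P → ∀ t : ℝ, 0 ≤ t → t ≤ 1 →
      η (fun ω => t * X ω + (1 - t) * Y ω) ≤ t * η X + (1 - t) * η Y)
    (hη_norm : η (fun _ => 0) = 0)
    (hη_cont : ∀ ε : ℝ, 0 < ε → ∃ δ : ℝ, 0 < δ ∧ ∀ X Y : Ω → ℝ,
      Integrable X P → Integrable Y P → (∫ ω, |X ω - Y ω| ∂P) < δ → |η X - η Y| < ε)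
    (A : Ω → Fin N → ℝ) (hA : Measurable A) (hApos : ∀ ω i, 0 < A ω i)
    (L : Ω → Fin N → Fin N → ℝ) (hL : Measurable L)
    (hLnn : ∀ ω i j, 0 ≤ L ω i j) (hLdiag : ∀ ω i, L ω i i = 0)
    (hLint : Integrable (fun ω => ∑ i, ∑ j, L ω i j) P)
    (b : ℝ) (hb : 0 < b)
    :
    innerRisk P η A L (outerRisk P η A L b) ≤ b := by
  have hBint : Integrable (fun ω => ∑ i, lbar (L ω) i) P := hLint
  have hpos : ∀ Y : Ω → Fin N → ℝ, (∀ ω i, 0 ≤ Y ω i) → ∀ ω i, 0 < A ω i + Y ω i :=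
    fun Y hY0 ω i => add_pos_of_pos_of_nonneg (hApos ω i) (hY0 ω i)
  have hint : ∀ Y : Ω → Fin N → ℝ, Measurable Y → (∀ ω i, 0 ≤ Y ω i) →
      Integrable (fun ω => aggLoss (fun i => A ω i + Y ω i) (L ω)) P := fun Y hY hY0 =>
    integrable_aggLoss (hA.add hY) (hpos Y hY0) hL hLnn hBint
  have hinner : ∀ Y : Ω → Fin N → ℝ, Measurable Y → (∀ ω i, 0 ≤ Y ω i) → ∀ c : ℝ,
      (∀ᵐ ω ∂P, ∑ i, Y ω i = c) →
      innerRisk P η A L c ≤ η (fun ω => aggLoss (fun i => A ω i + Y ω i) (L ω)) := by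
    intro Y hY hY0 c hc
    refine csInf_le ⟨0, ?_⟩ ⟨Y, hY, hY0, hc, rfl⟩
    rintro _ ⟨Z, hZ, hZ0, -, rfl⟩
    rw [← hη_norm]
    exact hη_mono _ _ (integrable_zero _ _ _) (hint Z hZ hZ0)
      (Filter.Eventually.of_forall fun ω => aggLoss_nonneg (hpos Z hZ0 ω) (hLnn ω))
  have hNpos : (0 : ℝ) < N := by exact_mod_cast hN
  have hnonempty : ∀ c : ℝ, 0 ≤ c → {r : ℝ | ∃ Y : Ω → Fin N → ℝ, Measurable Y ∧
      (∀ ω i, 0 ≤ Y ω i) ∧ (∀ᵐ ω ∂P, ∑ i, Y ω i = c) ∧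
      r = η (fun ω => aggLoss (fun i => A ω i + Y ω i) (L ω))}.Nonempty := fun c hc =>
    ⟨_, fun _ _ => c / N, measurable_const, fun _ _ => div_nonneg hc hNpos.le,
      Filter.Eventually.of_forall fun ω => by simp [mul_div_cancel₀, hNpos.ne'], rfl⟩
  have hcontAt : ∀ Z : Ω → ℝ, Integrable Z P → ∀ ε : ℝ, 0 < ε → ∃ δ : ℝ, 0 < δ ∧
      ∀ X : Ω → ℝ, Integrable X P → (∫ ω, |X ω - Z ω| ∂P) < δ → |η X - η Z| < ε := by
    intro Z hZ ε hε
    obtain ⟨δ, hδ, h⟩ := hη_cont ε hε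
    exact ⟨δ, hδ, fun X hX => h X Z hX hZ⟩
  have hbound : ∀ u : ℝ, 0 ≤ u → ∀ ω,
      |aggLoss (fun i => A ω i + u) (L ω)| ≤ ∑ i, lbar (L ω) i := by
    intro u hu ω
    have hp := hpos (fun _ _ => u) (fun _ _ => hu) ω
    rw [abs_of_nonneg (aggLoss_nonneg hp (hLnn ω))]
    exact aggLoss_le_sum_lbar hp (hLnn ω)
  set S : Set ℝ := {c : ℝ | 0 ≤ c ∧ innerRisk P η A L c ≤ b}
  have hSbdd : BddBelow S := ⟨0, fun c hc => hc.1⟩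
  have hSne : S.Nonempty := by
    have hlim := tendsto_of_dominated (η := η) (hcontAt _ (integrable_zero _ _ P)) hBint
      (fun n : ℕ => hint (fun _ _ => n) measurable_const fun _ _ => n.cast_nonneg)
      (integrable_zero _ _ P) (fun n => hbound n n.cast_nonneg)
      (fun ω => tendsto_aggLoss_add_atTop (hApos ω) (hLnn ω))
    rw [show η 0 = 0 from hη_norm] at hlim
    obtain ⟨n, hn⟩ := (hlim.eventually_le_const hb).exists
    refine ⟨N * n, by positivity, le_trans ?_ hn⟩
    exact hinner (fun _ _ => n) measurable_const (fun _ _ => n.cast_nonneg) _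
      (Filter.Eventually.of_forall fun ω => by simp)
  have hc0 : 0 ≤ sInf S := Real.sInf_nonneg fun c hc => hc.1
  change innerRisk P η A L (sInf S) ≤ b
  obtain ⟨c, -, hclim, hcS⟩ := exists_seq_tendsto_sInf hSne hSbdd
  rcases hc0.eq_or_lt with h0 | hcpos
  · rw [← h0] at hclim ⊢
    have hzero := hinner (fun _ _ => 0) measurable_const (fun _ _ => le_rfl) 0 (by simp)
    simp only [add_zero] at hzero
    refine hzero.trans ?_
    have hlim := tendsto_of_dominated (η := η)
      (hcontAt _ (integrable_aggLoss hA hApos hL hLnn hBint)) hBint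
      (fun n => hint (fun _ _ => c n) measurable_const fun _ _ => (hcS n).1)
      (integrable_aggLoss hA hApos hL hLnn hBint) (fun n => hbound (c n) (hcS n).1)
      (fun ω => tendsto_aggLoss_add_zero (hApos ω) (hLnn ω) (fun n => (hcS n).1) hclim)
    refine le_of_tendsto' hlim fun n => le_trans ?_ (hcS n).2
    refine le_csInf (hnonempty _ (hcS n).1) ?_
    rintro _ ⟨Y, hY, hY0, hYc, rfl⟩
    refine hη_mono _ _ (hint (fun _ _ => c n) measurable_const fun _ _ => (hcS n).1)
      (hint Y hY hY0) ?_
    filter_upwards [hYc] with ω hω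
    refine aggLoss_anti (hpos Y hY0 ω) (hLnn ω) fun i => ?_
    have := Finset.single_le_sum (fun i _ => hY0 ω i) (Finset.mem_univ i)
    linarith
  · have hle : ∀ n, innerRisk P η A L (sInf S) ≤
        sInf S / c n * b + (1 - sInf S / c n) * η (fun ω => ∑ i, lbar (L ω) i) := by
      intro n
      have hcn : sInf S ≤ c n := csInf_le hSbdd (hcS n)
      have hcnpos : 0 < c n := hcpos.trans_le hcn
      set s := sInf S / c n
      have hs0 : 0 < s := div_pos hcpos hcnpos
      have hs1 : s ≤ 1 := (div_le_one hcnpos).2 hcn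
      have hsc : s * c n = sInf S := div_mul_cancel₀ _ hcnpos.ne'
      have key : (innerRisk P η A L (sInf S) -
          (1 - s) * η (fun ω => ∑ i, lbar (L ω) i)) / s ≤ innerRisk P η A L (c n) := by
        refine le_csInf (hnonempty _ (hcS n).1) ?_
        rintro _ ⟨Y, hY, hY0, hYc, rfl⟩
        rw [div_le_iff₀' hs0, sub_le_iff_le_add]
        have hsY : Measurable fun ω i => s * Y ω i := by fun_prop
        have hsY0 : ∀ ω i, 0 ≤ s * Y ω i := fun ω i => mul_nonneg hs0.le (hY0 ω i)
        refine (hinner _ hsY hsY0 _ ?_).trans ((hη_mono _ _ (hint _ hsY hsY0)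
          (((hint Y hY hY0).const_mul s).add (hBint.const_mul (1 - s))) ?_).trans
          (hη_conv _ _ (hint Y hY hY0) hBint s hs0.le hs1))
        · filter_upwards [hYc] with ω hω
          rw [← Finset.mul_sum, hω, hsc]
        · refine Filter.Eventually.of_forall fun ω => ?_
          refine aggLoss_le_of_mul_le (hpos Y hY0 ω) (hpos _ hsY0 ω) (hLnn ω) hs0.le hs1
            fun i => ?_
          nlinarith [hApos ω i]
      rw [div_le_iff₀' hs0, sub_le_iff_le_add] at key
      exact key.trans (by gcongr; exact (hcS n).2)
    have hratio : Filter.Tendsto (fun n => sInf S / c n) Filter.atTop (nhds 1) := by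
      rw [← div_self hcpos.ne']
      exact tendsto_const_nhds.div hclim hcpos.ne'
    have hlim := (hratio.mul_const b).add
      ((hratio.const_sub 1).mul_const (η fun ω => ∑ i, lbar (L ω) i))
    simpa using ge_of_tendsto' hlim hle
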